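/- Zero curvature equations in components: let r be either the rational or the trigonometric r-matrix, S ⊂ ℂP¹ a finite set with integers N_a for a ∈ S, A a commutative ℂ-algebra, and Q an adelic element with coefficients in gl_N(A): Q^a(λ_a) = Σ_{n≥−N_a} Q^a_n λ_a^n with Q^a_n ∈ gl_N(A) for a ∈ S, and Q^a = 0 for a ∉ S. Define the Lax matrices V^b_n(λ) (gl_N(A)-valued rational functions of λ) as the coefficients of the generating series V^b(λ;μ_b) := Tr₂( ι_{μ_b} r₁₂(λ,μ) Q^b(μ_b)₂ ), via V^b(λ;μ_b) = Σ_{n≥−N_b} V^b_n(λ) μ_b^n for b ∈ ℂ and V^∞(λ;μ_∞) = Σ_{n≥−N_∞} V^∞_n(λ) μ_∞^{n+k+1} with k = 0 in the rational case and k = −1 in the trigonometric case. Suppose given ℂ-linear derivations ∂_{t^b_n} of A (b ∈ S, n ≥ −N_b), extended entrywise to matrices and coefficientwise to series, such that the Lax equations ∂_{t^b_n} Q^a(λ_a) = [ ι_{λ_a} V^b_n(λ), Q^a(λ_a) ] hold for all a, b ∈ S and all n ≥ −N_b. Then for all a, b ∈ S, m ≥ −N_a and n ≥ −N_b, the zero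 curvature equation ∂_{t^b_n} V^a_m(λ) − ∂_{t^a_m} V^b_n(λ) + [ V^a_m(λ), V^b_n(λ) ] = 0 holds as gl_N(A)-valued rational functions of λ. -/

import Mathlib

/-!
# Zero curvature equations in components

Let `r` be the rational (`isTrig = false`) or trigonometric (`isTrig = true`) r-matrix,
`S ⊂ ℂP¹` finite with pole orders `Nb a`, `A` a commutative `ℂ`-algebra, and `Q` an
adelic element with coefficients in `gl_N(A)` supported on `S` and bounded below by
`−Nb`.  The Lax matrices `V^b_n(λ)` are the coefficients of the generating series
`V^b(λ;μ_b) = Tr₂( ι_{μ_b} r₁₂(λ,μ) Q^b(μ_b)₂ )`, with `V^b(λ;μ_b) = Σ_n V^b_n(λ) μ_b^n`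
for `b ∈ ℂ` and `V^∞(λ;μ_∞) = Σ_n V^∞_n(λ) μ_∞^{n+k+1}` (`k = 0` rational, `k = −1`
trigonometric); here `ι_{μ_b}` expands the rational factor of `μ` in the kernel as a
series in `μ_b` with coefficients rational in `λ`, so that each `V^b_n(λ)` is a
`gl_N(A)`-valued rational function of `λ`, realised as a matrix over `A ⊗[ℂ] ℂ(λ)`.
Using `Tr₂(P₁₂M₂) = M`, `Tr₂(P⁻₁₂M₂) = P⁻M`, `Tr₂(P⁰₁₂M₂) = P⁰M`, one has
`Tr₂(ι_{μ_b} r₁₂ Q₂) = (ι_{μ_b}(scalar kernel))·Q^b(μ_b) − [trig] (P⁻+½P⁰)Q^b(μ_b)`.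

Given `ℂ`-linear derivations `∂_{t^b_n}` of `A` (extended entrywise to matrices and to
`A ⊗ ℂ(λ)` via `∂ ⊗ id`) satisfying the Lax equations
`∂_{t^b_n} Q^a(λ_a) = [ι_{λ_a}V^b_n(λ), Q^a(λ_a)]` (an identity of `λ_a`-Laurent series,
stated coefficientwise with Cauchy-product brackets), the zero curvature equations
`∂_{t^b_n}V^a_m(λ) − ∂_{t^a_m}V^b_n(λ) + [V^a_m(λ), V^b_n(λ)] = 0` hold as
`gl_N(A)`-valued rational functions of `λ`.
-/

set_option synthInstance.maxHeartbeats 1000000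
set_option maxHeartbeats 1000000
noncomputable section
open Polynomial TensorProduct

abbrev Rf : Type := RatFunc ℂ
abbrev Rf2 : Type := RatFunc Rf
/-- `ℂP¹ = ℂ ∪ {∞}`; `none` is the point at infinity -/
abbrev CP1 : Type := Option ℂ

def laurentCoeffAt {F : Type*} [Field F] (b : F) (f : RatFunc F) (n : ℤ) : F :=
  ((RatFunc.laurent b f : LaurentSeries F)).coeff n

def invSubst {F : Type*} [Field F] (f : RatFunc F) : RatFunc F :=
  (algebraMap F[X] (RatFunc F) f.num.reverse * RatFunc.X ^ f.denom.natDegree) /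
    (algebraMap F[X] (RatFunc F) f.denom.reverse * RatFunc.X ^ f.num.natDegree)

def expC {F : Type*} [Field F] (a : Option F) (f : RatFunc F) (n : ℤ) : F :=
  match a with
  | some b => laurentCoeffAt b f n
  | none => ((invSubst f : LaurentSeries F)).coeff n

def pt (b : CP1) : Option Rf := b.map (algebraMap ℂ Rf)

/-- scalar kernel of the r-matrix (`1/(μ−λ)` rational, `μ/(μ−λ)` trigonometric),
with outer variable `μ` and coefficients rational in `λ` -/
def kerS (isTrig : Bool) : Rf2 :=
  if isTrig then RatFunc.X * (RatFunc.X - RatFunc.C (RatFunc.X : Rf))⁻¹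
  else (RatFunc.X - RatFunc.C (RatFunc.X : Rf))⁻¹

/-- `ι_{μ_b}` of the scalar kernel: coefficient of `μ_b^p`, a rational function of `λ` -/
def gker (isTrig : Bool) (b : CP1) (p : ℤ) : Rf := expC (pt b) (kerS isTrig) p

/-- `k = 0` in the rational case and `k = −1` in the trigonometric case -/
def kval (isTrig : Bool) : ℤ := if isTrig then -1 else 0

/-- the `μ_b`-power at which `V^b_n` sits in the generating series: `n` at finite points,
`n + k + 1` at `∞` -/
def idx (isTrig : Bool) (b : CP1) (n : ℤ) : ℤ :=
  if b = none then n + kval isTrig + 1 else n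

section
variable {R : Type*} [CommRing R] {N : ℕ}

/-- strictly lower triangular part -/
def lowP (M : Matrix (Fin N) (Fin N) R) : Matrix (Fin N) (Fin N) R :=
  Matrix.of fun i j => if j < i then M i j else 0
/-- diagonal part -/
def diagP (M : Matrix (Fin N) (Fin N) R) : Matrix (Fin N) (Fin N) R :=
  Matrix.of fun i j => if i = j then M i j else 0

end

variable {A : Type*} [CommRing A] [Algebra ℂ A] {N : ℕ}

/-- the Lax matrix `V^b_n(λ)` as a `gl_N(A)`-valued rational function of `λ`
(a matrix over `A ⊗[ℂ] ℂ(λ)`) -/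
def Vlax (isTrig : Bool) (Q : CP1 → ℤ → Matrix (Fin N) (Fin N) A) (b : CP1) (n : ℤ) :
    Matrix (Fin N) (Fin N) (A ⊗[ℂ] Rf) :=
  (∑ᶠ p : ℤ, (Q b (idx isTrig b n - p)).map (fun x => x ⊗ₜ[ℂ] gker isTrig b p))
    - (if isTrig then
        (lowP (Q b (idx isTrig b n)) + (2:ℂ)⁻¹ • diagP (Q b (idx isTrig b n))).map
          (fun x => x ⊗ₜ[ℂ] (1 : Rf))
      else 0)

/-- `ι_{λ_a} V^b_n(λ)`: coefficient of `λ_a^t` of the Laurent expansion at `a` of the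
Lax matrix `V^b_n` -/
def iV (isTrig : Bool) (Q : CP1 → ℤ → Matrix (Fin N) (Fin N) A) (a b : CP1) (n t : ℤ) :
    Matrix (Fin N) (Fin N) A :=
  (∑ᶠ p : ℤ, expC a (gker isTrig b p) t • Q b (idx isTrig b n - p))
    - (if isTrig = true ∧ t = 0 then
        lowP (Q b (idx isTrig b n)) + (2:ℂ)⁻¹ • diagP (Q b (idx isTrig b n))
      else 0)

/-- a derivation `∂` of `A`, extended to `A ⊗[ℂ] ℂ(λ)` as `∂ ⊗ id` and then entrywise -/
def Dext (d : Derivation ℂ A A) (M : Matrix (Fin N) (Fin N) (A ⊗[ℂ] Rf)) :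
    Matrix (Fin N) (Fin N) (A ⊗[ℂ] Rf) :=
  M.map (LinearMap.rTensor Rf (d : A →ₗ[ℂ] A))

section Expansion

open scoped RatFunc

variable {F : Type*} [Field F]

theorem algebraMap_reverse_eq (p : F[X]) :
    algebraMap F[X] (RatFunc F) p.reverse =
      eval₂ RatFunc.C (RatFunc.X : RatFunc F)⁻¹ p * RatFunc.X ^ p.natDegree := by
  have hmap : ∀ q : F[X], algebraMap F[X] (RatFunc F) q = eval₂ RatFunc.C RatFunc.X q := by
    intro q
    have : algebraMap F[X] (RatFunc F) = eval₂RingHom RatFunc.C RatFunc.X :=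
      Polynomial.ringHom_ext' (by ext; simp) (by simp)
    rw [this, coe_eval₂RingHom]
  have : Invertible (RatFunc.X : RatFunc F)⁻¹ :=
    invertibleOfNonzero (inv_ne_zero RatFunc.X_ne_zero)
  rw [← eval₂_reverse_mul_pow (RatFunc.C : F →+* RatFunc F) (RatFunc.X : RatFunc F)⁻¹ p,
    mul_assoc, ← mul_pow, inv_mul_cancel₀ RatFunc.X_ne_zero, one_pow, mul_one, invOf_eq_inv,
    inv_inv, hmap]

variable (F) in
theorem injective_eval₂_inv_X :
    Function.Injective (eval₂RingHom RatFunc.C (RatFunc.X : RatFunc F)⁻¹) := by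
  rw [injective_iff_map_eq_zero]
  intro p hp
  have h := algebraMap_reverse_eq p
  rw [coe_eval₂RingHom] at hp
  rw [hp, zero_mul, map_eq_zero_iff _ (RatFunc.algebraMap_injective F), reverse_eq_zero] at h
  exact h

variable (F) in
/-- the inversion `X ↦ X⁻¹` of rational functions -/
def invHom : RatFunc F →+* RatFunc F :=
  RatFunc.liftRingHom (eval₂RingHom RatFunc.C (RatFunc.X : RatFunc F)⁻¹)
    (nonZeroDivisors_le_comap_nonZeroDivisors_of_injective _ (injective_eval₂_inv_X F))

theorem invSubst_eq_invHom (f : RatFunc F) : invSubst f = invHom F f := by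
  have hX : (RatFunc.X : RatFunc F) ≠ 0 := RatFunc.X_ne_zero
  have hd : eval₂ RatFunc.C (RatFunc.X : RatFunc F)⁻¹ f.denom ≠ 0 :=
    (map_ne_zero_iff _ (injective_eval₂_inv_X F)).2 f.denom_ne_zero
  rw [invHom, RatFunc.liftRingHom_apply, invSubst, algebraMap_reverse_eq, algebraMap_reverse_eq,
    coe_eval₂RingHom, div_eq_div_iff (by positivity) hd]
  ring

/-- the Laurent expansion `ι` at a point of the projective line over `F` -/
def expHom (a : Option F) : RatFunc F →+* LaurentSeries F :=
  (algebraMap (RatFunc F) (LaurentSeries F)).comp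
    (match a with
      | some b => (RatFunc.laurent b : RatFunc F →ₐ[F] RatFunc F).toRingHom
      | none => invHom F)

theorem expC_eq_coeff (a : Option F) (f : RatFunc F) (n : ℤ) :
    expC a f n = (expHom a f).coeff n := by
  cases a
  · simp [expC, expHom, invSubst_eq_invHom]
  · rfl

theorem expHom_C (a : Option F) (c : F) : expHom a (RatFunc.C c) = HahnSeries.C c := by
  have h : algebraMap (RatFunc F) (LaurentSeries F) (RatFunc.C c) = HahnSeries.C c := by
    have := RatFunc.coe_coe (Polynomial.C c)
    simpa using this.symm
  cases a
  · simp [expHom, invHom, ← RatFunc.algebraMap_C]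
    simp [h]
  · simp [expHom, h]

theorem expHom_X (a : Option F) :
    expHom a RatFunc.X =
      match a with
      | some b => HahnSeries.single 1 1 + HahnSeries.C b
      | none => HahnSeries.single (-1) 1 := by
  cases a with
  | none =>
    have : invHom F RatFunc.X = RatFunc.X⁻¹ := by
      rw [← RatFunc.algebraMap_X, invHom, RatFunc.liftRingHom_algebraMap]
      simp
    simp [expHom, this, HahnSeries.inv_single]
  | some b =>
    have h := expHom_C (some 0) b
    simp [expHom] at h ⊢
    simp [h]

end Expansion

section MulVar

variable {F V W : Type*} [CommRing F] [AddCommGroup V] [Module F V] [AddCommGroup W] [Module F W]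

/-- multiplication by the global coordinate, on the coefficients of an expansion at `a` -/
def mulVar (a : Option F) (f : ℤ → V) (n : ℤ) : V :=
  match a with
  | some b => f (n - 1) + b • f n
  | none => f (n + 1)

/-- `mulVar` in the trigonometric case, the identity in the rational case -/
def twist (isTrig : Bool) (a : Option F) (f : ℤ → V) : ℤ → V :=
  if isTrig then mulVar a f else f

theorem mulVar_map (φ : V →ₗ[F] W) (a : Option F) (f : ℤ → V) (n : ℤ) :
    mulVar a (fun k => φ (f k)) n = φ (mulVar a f n) := by
  cases a <;> simp [mulVar]

theorem twist_map (φ : V →ₗ[F] W) (isTrig : Bool) (a : Option F) (f : ℤ → V) (n : ℤ) :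
    twist isTrig a (fun k => φ (f k)) n = φ (twist isTrig a f n) := by
  cases isTrig <;> simp [twist, mulVar_map]

theorem mulVar_add (a : Option F) (f g : ℤ → V) (n : ℤ) :
    mulVar a (fun k => f k + g k) n = mulVar a f n + mulVar a g n := by
  cases a <;> simp [mulVar]
  abel

theorem mulVar_sub (a : Option F) (f g : ℤ → V) (n : ℤ) :
    mulVar a (fun k => f k - g k) n = mulVar a f n - mulVar a g n := by
  cases a <;> simp [mulVar, smul_sub]
  abel

end MulVar

theorem mulVar_pt {V : Type*} [AddCommGroup V] [Module Rf V] [Module ℂ V] [IsScalarTower ℂ Rf V]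
    (a : CP1) (f : ℤ → V) (n : ℤ) : mulVar (pt a) f n = mulVar a f n := by
  cases a <;> simp only [mulVar, pt, Option.map_none, Option.map_some, algebraMap_smul]

theorem coeff_expHom_X_mul {F : Type*} [Field F] (a : Option F) (G : LaurentSeries F) (n : ℤ) :
    (expHom a RatFunc.X * G).coeff n = mulVar a G.coeff n := by
  rw [expHom_X]
  cases a with
  | none => simp [mulVar, HahnSeries.coeff_single_mul]
  | some b => simp [mulVar, add_mul, HahnSeries.coeff_single_mul]

theorem expC_X_mul {F : Type*} [Field F] (a : Option F) (f : RatFunc F) (n : ℤ) :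
    expC a (RatFunc.X * f) n = mulVar a (expC a f) n := by
  have : expC a f = (expHom a f).coeff := funext (expC_eq_coeff a f)
  rw [expC_eq_coeff, map_mul, coeff_expHom_X_mul, this]

theorem expC_add {F : Type*} [Field F] (a : Option F) (f g : RatFunc F) (n : ℤ) :
    expC a (f + g) n = expC a f n + expC a g n := by
  simp [expC_eq_coeff]

theorem expC_C {F : Type*} [Field F] (a : Option F) (c : F) (n : ℤ) :
    expC a (RatFunc.C c) n = if n = 0 then c else 0 := by
  rw [expC_eq_coeff, expHom_C, HahnSeries.C_apply]
  by_cases h : n = 0 <;> simp [h]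

theorem ratFunc_X_sub_C_ne_zero {F : Type*} [Field F] (c : F) :
    (RatFunc.X : RatFunc F) - RatFunc.C c ≠ 0 := by
  intro h
  have h1 := congrArg (fun f => expC (some (0 : F)) f 1) h
  simp [expC_eq_coeff, expHom_X, expHom_C] at h1

theorem expC_eventually_zero {F : Type*} [Field F] (a : Option F) (f : RatFunc F) :
    ∃ n₀ : ℤ, ∀ n < n₀, expC a f n = 0 := by
  refine ⟨(expHom a f).order, fun n hn => ?_⟩
  rw [expC_eq_coeff, HahnSeries.coeff_eq_zero_of_lt_order hn]

/-- expansion coefficients as a linear map -/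
def expL (a : CP1) (n : ℤ) : Rf →ₗ[ℂ] ℂ where
  toFun f := expC a f n
  map_add' f g := expC_add a f g n
  map_smul' c f := by
    rw [RatFunc.smul_eq_C_mul, expC_eq_coeff, map_mul, expHom_C, HahnSeries.C_mul_eq_smul,
      expC_eq_coeff]
    rfl

theorem mulVar_gker (isTrig : Bool) (a : CP1) (p : ℤ) :
    mulVar a (gker isTrig a) p - RatFunc.X * gker isTrig a p =
      twist isTrig a (Pi.single 0 1) p := by
  have hne := ratFunc_X_sub_C_ne_zero (RatFunc.X : Rf)
  have hk : RatFunc.X * kerS isTrig - RatFunc.C (RatFunc.X : Rf) * kerS isTrig =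
      if isTrig then RatFunc.X * 1 else 1 := by
    rw [← sub_mul, kerS]
    cases isTrig
    · simpa using mul_inv_cancel₀ hne
    · simp [mul_left_comm _ (RatFunc.X : Rf2), mul_inv_cancel₀ hne]
  have h1 : expC (pt a) (1 : Rf2) = Pi.single 0 1 := by
    funext n
    rw [← map_one RatFunc.C, expC_C, Pi.single_apply]
  have h := congrArg (fun f => expC (pt a) f p) hk
  simp only [sub_eq_add_neg, ← neg_mul, ← map_neg, expC_add, expC_X_mul] at h
  rw [expC_eq_coeff _ (_ * _), map_mul, expHom_C, HahnSeries.C_mul_eq_smul, HahnSeries.coeff_smul,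
    ← expC_eq_coeff, mulVar_pt, smul_eq_mul, neg_mul, ← sub_eq_add_neg] at h
  refine h.trans ?_
  cases isTrig <;>
    simp only [twist, if_true, Bool.false_eq_true, if_false, h1, expC_X_mul, mulVar_pt]

theorem eq_zero_of_eventually_zero {V : Type*} [Zero V] {g : ℤ → V} {m : ℤ}
    (hg : ∃ n₀ : ℤ, ∀ n < n₀, g n = 0) (hrec : ∀ n < m, g (n - 1) = 0 → g n = 0) :
    ∀ n < m, g n = 0 := by
  obtain ⟨n₀, hn₀⟩ := hg
  have key : ∀ k : ℕ, ∀ n : ℤ, n < m → n < n₀ + k → g n = 0 := by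
    intro k
    induction k with
    | zero => intro n _ h; exact hn₀ n (by simpa using h)
    | succ k ih =>
      intro n hn hnk
      exact hrec n hn (ih (n - 1) (by omega) (by push_cast at hnk; omega))
  exact fun n hn => key (n + 1 - n₀).toNat n hn (by omega)

theorem eq_zero_of_smul_eq_X_mul {c : ℂ} {f : Rf} (h : c • f - RatFunc.X * f = 0) : f = 0 := by
  rw [RatFunc.smul_eq_C_mul, ← sub_mul, mul_eq_zero] at h
  refine h.resolve_left fun h => ratFunc_X_sub_C_ne_zero c ?_
  rw [← neg_sub, h, neg_zero]

theorem gker_of_neg (isTrig : Bool) (a : CP1) (p : ℤ) (hp : p < 0) : gker isTrig a p = 0 := by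
  refine eq_zero_of_eventually_zero (m := 0) (expC_eventually_zero (pt a) (kerS isTrig))
    (fun n hn (ih : gker isTrig a (n - 1) = 0) => ?_) p hp
  change gker isTrig a n = 0
  cases a with
  | none =>
    have := mulVar_gker isTrig none (n - 1)
    rw [ih] at this
    cases isTrig <;>
      simpa [mulVar, twist, Pi.single_apply, show n ≠ 0 by omega, show n - 1 ≠ 0 by omega]
        using this
  | some c =>
    have := mulVar_gker isTrig (some c) n
    apply eq_zero_of_smul_eq_X_mul (c := c)
    cases isTrig <;>
      simpa [mulVar, twist, Pi.single_apply, ih, show n ≠ 0 by omega, show n - 1 ≠ 0 by omega]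
        using this

theorem eq_zero_of_mulVar_eq {b : CP1} {g : ℤ → Rf} (hg : ∃ n₀ : ℤ, ∀ n < n₀, g n = 0)
    (h : ∀ n, mulVar b g n - RatFunc.X * g n = 0) (n : ℤ) : g n = 0 := by
  refine eq_zero_of_eventually_zero (m := n + 1) hg (fun k _ ih => ?_) n (by omega)
  cases b with
  | none => simpa [mulVar, ih] using h (k - 1)
  | some c =>
    apply eq_zero_of_smul_eq_X_mul (c := c)
    simpa [mulVar, ih] using h k

theorem algebraMap_twist_single (isTrig : Bool) (b : CP1) (j : ℤ) :
    twist isTrig b (Pi.single 0 1 : ℤ → Rf) j =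
      algebraMap ℂ Rf (twist isTrig b (Pi.single 0 1) j) := by
  refine Eq.trans ?_ (twist_map (Algebra.linearMap ℂ Rf) isTrig b (Pi.single 0 1) j)
  congr 1
  funext k
  by_cases hk : k = 0 <;> simp [hk]

/-- coefficient of `λ_a^i μ_b^j` in the iterated expansion `ι_{λ_a} ι_{μ_b}` of the kernel -/
def kerCoeff (isTrig : Bool) (a b : CP1) (i j : ℤ) : ℂ := expC a (gker isTrig b j) i

theorem kerCoeff_of_neg_right (isTrig : Bool) (a b : CP1) (i j : ℤ) (hj : j < 0) :
    kerCoeff isTrig a b i j = 0 := by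
  rw [kerCoeff, gker_of_neg _ _ _ hj]
  exact (expL a i).map_zero

theorem mulVar_kerCoeff (isTrig : Bool) (a b : CP1) (i j : ℤ) :
    mulVar b (kerCoeff isTrig a b i) j =
      mulVar a (fun i => kerCoeff isTrig a b i j) i +
        if i = 0 then twist isTrig b (Pi.single 0 1) j else 0 := by
  have h1 : mulVar b (gker isTrig b) j =
      RatFunc.X * gker isTrig b j + twist isTrig b (Pi.single 0 1) j := by
    rw [← mulVar_gker]; ring
  have h3 := mulVar_map (expL a i) b (gker isTrig b) j
  rw [h1, map_add, algebraMap_twist_single] at h3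
  refine h3.trans (congrArg₂ (· + ·) (expC_X_mul a (gker isTrig b j) i) (expC_C a _ i))

theorem kerCoeff_of_neg_left (isTrig : Bool) {a b : CP1} (hab : a ≠ b) (i j : ℤ) (hi : i < 0) :
    kerCoeff isTrig a b i j = 0 := by
  refine congrFun (eq_zero_of_eventually_zero (m := j + 1)
    (g := fun j => fun i : Set.Iio (0 : ℤ) => kerCoeff isTrig a b i j)
    ⟨0, fun n hn => funext fun i => kerCoeff_of_neg_right _ _ _ _ _ hn⟩ (fun n _ ih => ?_) j
    (by omega)) ⟨i, hi⟩
  have ih' : ∀ i < 0, kerCoeff isTrig a b i (n - 1) = 0 := fun i hi => congrFun ih ⟨i, hi⟩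
  refine funext fun ⟨i, hi⟩ => ?_
  refine eq_zero_of_eventually_zero (g := fun i => kerCoeff isTrig a b i n) (m := 0)
    (expC_eventually_zero a (gker isTrig b n))
    (fun i hi (ih2 : kerCoeff isTrig a b (i - 1) n = 0) => ?_) i hi
  match a, b with
  | none, none => exact absurd rfl hab
  | some a, none =>
    have := mulVar_kerCoeff isTrig (some a) none i (n - 1)
    simpa [mulVar, hi.ne, ih' i hi, ih' (i - 1) (by omega)] using this
  | none, some b =>
    have := mulVar_kerCoeff isTrig none (some b) (i - 1) n
    simpa [mulVar, show i - 1 ≠ 0 by omega, ih' (i - 1) (by omega), ih2] using this.symm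
  | some a, some b =>
    have := mulVar_kerCoeff isTrig (some a) (some b) i n
    simp only [mulVar, hi.ne, ih' i hi, ih2, if_false, add_zero, zero_add, smul_eq_mul] at this
    have hne : b - a ≠ 0 := fun h => hab (by rw [sub_eq_zero.1 h])
    exact (mul_eq_zero.1 (show (b - a) * _ = 0 by rw [sub_mul, this, sub_self])).resolve_left hne

/-- the defect of skew-symmetry of the kernel under exchanging the order of the expansions -/
def kerDefect (isTrig : Bool) (a b : CP1) (i j : ℤ) : ℂ :=
  kerCoeff isTrig a b i j + kerCoeff isTrig b a j i -
    if isTrig = true ∧ i = 0 ∧ j = 0 then 1 else 0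

theorem kerDefect_comm (isTrig : Bool) (a b : CP1) (i j : ℤ) :
    kerDefect isTrig a b i j = kerDefect isTrig b a j i := by
  simp only [kerDefect, add_comm, and_comm]

theorem twist_kerDefect (isTrig : Bool) (a b : CP1) (i j : ℤ) :
    twist isTrig b (kerDefect isTrig a b i) j =
      twist isTrig a (fun k => kerCoeff isTrig a b k j) i +
        twist isTrig b (fun k => kerCoeff isTrig b a k i) j := by
  unfold kerDefect
  cases isTrig
  · simp [twist]
  · have hδ : (fun k : ℤ => if (True ∧ i = 0 ∧ k = 0) then (1 : ℂ) else 0) = fun k =>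
        (if i = 0 then LinearMap.id else (0 : ℂ →ₗ[ℂ] ℂ)) ((Pi.single 0 1 : ℤ → ℂ) k) := by
      funext k
      by_cases hi : i = 0 <;> by_cases hk : k = 0 <;> simp [hi, hk]
    simp only [twist, if_true]
    rw [mulVar_sub, mulVar_add, mulVar_kerCoeff, hδ, mulVar_map]
    by_cases hi : i = 0 <;> simp [twist, hi]; ring

theorem mulVar_kerDefect (isTrig : Bool) (a b : CP1) (i j : ℤ) :
    mulVar b (kerDefect isTrig a b i) j = mulVar a (fun i => kerDefect isTrig a b i j) i := by
  simp only [kerDefect_comm isTrig a b _ j]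
  cases isTrig
  · have h1 := mulVar_kerCoeff false a b i j
    have h2 := mulVar_kerCoeff false b a j i
    have e1 : kerDefect false a b i = fun j => kerCoeff false a b i j + kerCoeff false b a j i := by
      funext j; simp [kerDefect]
    have e2 : kerDefect false b a j = fun i => kerCoeff false b a j i + kerCoeff false a b i j := by
      funext i; simp [kerDefect]
    rw [e1, e2, mulVar_add, mulVar_add, h1, h2]
    by_cases hi : i = 0 <;> by_cases hj : j = 0 <;> simp [twist, hi, hj] <;> ring
  · have h1 := twist_kerDefect true a b i j
    have h2 := twist_kerDefect true b a j i
    simp only [twist, if_true] at h1 h2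
    rw [h1, h2, add_comm]

theorem kerDefect_self (isTrig : Bool) (a : CP1) (i j : ℤ) :
    kerDefect isTrig a a (i + 1) (j - 1) = kerDefect isTrig a a i j := by
  cases a with
  | none => simpa [mulVar] using (mulVar_kerDefect isTrig none none i (j - 1)).symm
  | some c => simpa [mulVar] using (mulVar_kerDefect isTrig (some c) (some c) (i + 1) j)

theorem kerDefect_of_neg_right (isTrig : Bool) {a b : CP1} (hab : a ≠ b) (i j : ℤ) (hj : j < 0) :
    kerDefect isTrig a b i j = 0 := by
  simp [kerDefect, kerCoeff_of_neg_right _ _ _ _ _ hj, kerCoeff_of_neg_left _ hab.symm _ _ hj,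
    hj.ne]

theorem kerDefect_of_ne (isTrig : Bool) {a b : CP1} (hab : a ≠ b) (i j : ℤ) :
    kerDefect isTrig a b i j = 0 := by
  wlog hb : b ≠ none generalizing a b i j
  · rw [kerDefect_comm]
    exact this hab.symm j i fun h => hab (h.trans (not_not.1 hb).symm)
  obtain ⟨b, rfl⟩ := Option.ne_none_iff_exists'.1 hb
  refine congrFun (eq_zero_of_eventually_zero (m := i + 1) (g := kerDefect isTrig a (some b))
    ⟨0, fun n hn => funext fun j => ?_⟩ (fun n _ ih => ?_) i (by omega)) j
  · rw [kerDefect_comm]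
    exact kerDefect_of_neg_right _ hab.symm _ _ hn
  have ih' : ∀ j, kerDefect isTrig a (some b) (n - 1) j = 0 := congrFun ih
  funext j
  cases a with
  | none =>
    simpa [mulVar, ih'] using (mulVar_kerDefect isTrig none (some b) (n - 1) j).symm
  | some a =>
    refine eq_zero_of_eventually_zero (m := j + 1) (g := kerDefect isTrig (some a) (some b) n)
      ⟨0, fun j hj => kerDefect_of_neg_right _ hab _ _ hj⟩ (fun j _ ih2 => ?_) j (by omega)
    have := mulVar_kerDefect isTrig (some a) (some b) n j
    simp only [mulVar, ih', ih2, zero_add, smul_eq_mul] at this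
    have hne : b - a ≠ 0 := fun h => hab (by rw [sub_eq_zero.1 h])
    exact (mul_eq_zero.1 (show (b - a) * _ = 0 by rw [sub_mul, this, sub_self])).resolve_left hne

section Convolution

/-- vanishing in sufficiently negative degrees -/
def BoundedBelow {V : Type*} [Zero V] (f : ℤ → V) : Prop := ∃ n₀ : ℤ, ∀ n < n₀, f n = 0

/-- Cauchy product of sequences of coefficients in `ℂ(λ)` and in `ℂ` -/
def cauchyProd (f : ℤ → Rf) (e : ℤ → ℂ) (n : ℤ) : Rf := ∑ᶠ p, e (n - p) • f p

theorem cauchyProd_support_finite {f : ℤ → Rf} {e : ℤ → ℂ} (hf : BoundedBelow f)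
    (he : BoundedBelow e) (n : ℤ) : (Function.support fun p => e (n - p) • f p).Finite := by
  obtain ⟨a, ha⟩ := hf
  obtain ⟨b, hb⟩ := he
  refine (Set.finite_Icc a (n - b)).subset fun p hp => ?_
  by_contra h
  rw [Set.mem_Icc, not_and_or, not_le, not_le] at h
  refine hp ?_
  rcases h with h | h
  · simp [ha p h]
  · simp [hb (n - p) (by omega)]

theorem cauchyProd_mulVar_right {f : ℤ → Rf} {e : ℤ → ℂ} (hf : BoundedBelow f)
    (he : BoundedBelow e) (a : CP1) (n : ℤ) :
    cauchyProd f (mulVar a e) n = mulVar a (cauchyProd f e) n := by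
  cases a with
  | none => simp only [cauchyProd, mulVar, sub_add_eq_add_sub]
  | some c =>
    simp only [cauchyProd, mulVar, smul_finsum, sub_right_comm n _ 1]
    rw [← finsum_add_distrib (cauchyProd_support_finite hf he _)
      (((cauchyProd_support_finite hf he n).subset fun p hp h => hp (by simp [h])))]
    simp [add_smul, mul_smul]

theorem cauchyProd_mulVar_left {f : ℤ → Rf} {e : ℤ → ℂ} (hf : BoundedBelow f)
    (he : BoundedBelow e) (a : CP1) (n : ℤ) :
    cauchyProd (mulVar a f) e n = mulVar a (cauchyProd f e) n := by
  cases a with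
  | none =>
    simp only [cauchyProd, mulVar]
    rw [← finsum_comp_equiv (Equiv.addRight (1 : ℤ)) (f := fun p => e (n + 1 - p) • f p)]
    simp
  | some c =>
    simp only [cauchyProd, mulVar, smul_finsum]
    rw [← finsum_comp_equiv (Equiv.subRight (1 : ℤ)) (f := fun p => e (n - 1 - p) • f p)]
    rw [← finsum_add_distrib]
    · simp [smul_add, smul_comm c]
    · have := (cauchyProd_support_finite hf he (n - 1)).preimage
        (Equiv.subRight (1 : ℤ)).injective.injOn
      exact this
    · exact (cauchyProd_support_finite hf he n).subset fun p hp h => hp (by simp [h])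

theorem cauchyProd_single {e : ℤ → ℂ} (n : ℤ) :
    cauchyProd (Pi.single 0 1) e n = algebraMap ℂ Rf (e n) := by
  rw [cauchyProd, finsum_eq_single _ 0 fun p hp => by simp [hp]]
  simp only [sub_zero, Pi.single_eq_same, Algebra.algebraMap_eq_smul_one]

theorem boundedBelow_single {V : Type*} [Zero V] (v : V) :
    BoundedBelow (Pi.single 0 v : ℤ → V) :=
  ⟨0, fun n hn => by simp [hn.ne]⟩

theorem boundedBelow_gker (isTrig : Bool) (a : CP1) : BoundedBelow (gker isTrig a) :=
  ⟨0, gker_of_neg isTrig a⟩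

theorem BoundedBelow.mulVar {V : Type*} [AddCommGroup V] [Module ℂ V] {e : ℤ → V}
    (he : BoundedBelow e) (a : CP1) : BoundedBelow (mulVar a e) := by
  obtain ⟨b, hb⟩ := he
  refine ⟨b - 1, fun n hn => ?_⟩
  cases a <;> simp [_root_.mulVar, hb n (by omega), hb (n - 1) (by omega), hb (n + 1) (by omega)]

theorem boundedBelow_kerCoeff (isTrig : Bool) (a b : CP1) (j : ℤ) :
    BoundedBelow fun i => kerCoeff isTrig a b i j :=
  expC_eventually_zero a (gker isTrig b j)

theorem mulVar_cauchyProd_gker (isTrig : Bool) (a : CP1) {e : ℤ → ℂ} (he : BoundedBelow e)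
    (n : ℤ) :
    mulVar a (cauchyProd (gker isTrig a) e) n - RatFunc.X * cauchyProd (gker isTrig a) e n =
      algebraMap ℂ Rf (twist isTrig a e n) := by
  have hf := boundedBelow_gker isTrig a
  have hX : RatFunc.X * cauchyProd (gker isTrig a) e n =
      ∑ᶠ p, e (n - p) • (RatFunc.X * gker isTrig a p) := by
    rw [cauchyProd, mul_finsum]
    simp only [mul_smul_comm]
  have hdiff : mulVar a (cauchyProd (gker isTrig a) e) n -
      RatFunc.X * cauchyProd (gker isTrig a) e n =
        cauchyProd (twist isTrig a (Pi.single 0 1)) e n := by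
    rw [hX, ← cauchyProd_mulVar_left hf he, cauchyProd, ← finsum_sub_distrib
      (cauchyProd_support_finite (hf.mulVar a) he n)
      ((cauchyProd_support_finite hf he n).subset fun p hp h => hp ?_)]
    · simp only [← smul_sub, mulVar_gker, cauchyProd]
    · simp only at h
      rw [← mul_smul_comm, h, mul_zero]
  rw [hdiff]
  cases isTrig
  · exact cauchyProd_single n
  · have h1 := cauchyProd_mulVar_left (boundedBelow_single (1 : Rf)) he a n
    refine h1.trans ?_
    rw [funext fun k => cauchyProd_single (e := e) k]
    exact mulVar_map (Algebra.linearMap ℂ Rf) a e n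

theorem cauchyProd_add {f : ℤ → Rf} {e e' : ℤ → ℂ} (hf : BoundedBelow f)
    (he : BoundedBelow e) (he' : BoundedBelow e') (n : ℤ) :
    cauchyProd f (fun k => e k + e' k) n = cauchyProd f e n + cauchyProd f e' n := by
  simp only [cauchyProd, add_smul]
  exact finsum_add_distrib (cauchyProd_support_finite hf he n)
    (cauchyProd_support_finite hf he' n)

theorem cauchyProd_smul (f : ℤ → Rf) (e : ℤ → ℂ) (c : ℂ) (n : ℤ) :
    cauchyProd f (fun k => c • e k) n = c • cauchyProd f e n := by
  simp only [cauchyProd, smul_finsum, smul_smul, smul_eq_mul]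

theorem cauchyProd_ite (f : ℤ → Rf) (c : ℂ) (n : ℤ) :
    cauchyProd f (fun k => if k = 0 then c else 0) n = c • f n := by
  rw [cauchyProd, finsum_eq_single _ n fun p hp => by simp [sub_eq_zero, hp.symm]]
  simp

/-- coefficient of `μ_a^i ν_b^j` in `r(λ,μ) r(λ,ν) - r(λ,μ) r(μ,ν) - r(λ,ν) r(ν,μ)` for the scalar
kernel `r`, where `r(μ,ν)` is first expanded in `ν` and `r(ν,μ)` first in `μ` -/
def curvCoeff (isTrig : Bool) (a b : CP1) (i j : ℤ) : Rf :=
  gker isTrig a i * gker isTrig b j -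
    cauchyProd (gker isTrig a) (fun k => kerCoeff isTrig a b k j) i -
    cauchyProd (gker isTrig b) (fun k => kerCoeff isTrig b a k i) j

theorem mulVar_cauchyProd_kerCoeff (isTrig : Bool) (a b : CP1) (i j : ℤ) :
    mulVar b (fun j => cauchyProd (gker isTrig a) (fun k => kerCoeff isTrig a b k j) i) j =
      mulVar a (cauchyProd (gker isTrig a) (fun k => kerCoeff isTrig a b k j)) i +
        twist isTrig b (Pi.single 0 1 : ℤ → ℂ) j • gker isTrig a i := by
  have hf := boundedBelow_gker isTrig a
  have he := boundedBelow_kerCoeff isTrig a b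
  have h1 : mulVar b (fun j => cauchyProd (gker isTrig a) (fun k => kerCoeff isTrig a b k j) i) j =
      cauchyProd (gker isTrig a) (fun k => mulVar b (kerCoeff isTrig a b k) j) i := by
    cases b with
    | none => rfl
    | some c =>
      obtain ⟨m, hm⟩ := he j
      simp only [mulVar]
      rw [cauchyProd_add hf (he (j - 1)) ⟨m, fun n hn => by simp only [hm n hn, smul_zero]⟩,
        cauchyProd_smul]
  rw [h1, ← cauchyProd_mulVar_right hf (he j), ← cauchyProd_ite, ← cauchyProd_add hf
    ((he j).mulVar a) ⟨0, fun n hn => if_neg hn.ne⟩]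
  simp only [mulVar_kerCoeff]

theorem mulVar_curvCoeff (isTrig : Bool) (a b : CP1) (i j : ℤ) :
    mulVar b (curvCoeff isTrig a b i) j - RatFunc.X * curvCoeff isTrig a b i j =
      -algebraMap ℂ Rf (twist isTrig b (kerDefect isTrig a b i) j) := by
  have h1 : mulVar b (fun j => gker isTrig a i * gker isTrig b j) j =
      gker isTrig a i * mulVar b (gker isTrig b) j :=
    mulVar_map (LinearMap.mulLeft ℂ (gker isTrig a i)) b (gker isTrig b) j
  have h2 := mulVar_cauchyProd_kerCoeff isTrig a b i j
  have h3 := mulVar_cauchyProd_gker isTrig a (boundedBelow_kerCoeff isTrig a b j) i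
  have h4 := mulVar_cauchyProd_gker isTrig b (boundedBelow_kerCoeff isTrig b a i) j
  have h5 := mulVar_gker isTrig b j
  have h6 : twist isTrig b (Pi.single 0 1 : ℤ → Rf) j =
      algebraMap ℂ Rf (twist isTrig b (Pi.single 0 1) j) := algebraMap_twist_single isTrig b j
  unfold curvCoeff
  rw [mulVar_sub, mulVar_sub, h1, h2, twist_kerDefect, map_add, ← h3, ← h4,
    Algebra.smul_def, ← h6, ← h5]
  ring

theorem boundedBelow_curvCoeff (isTrig : Bool) (a b : CP1) (i : ℤ) :
    BoundedBelow (curvCoeff isTrig a b i) := by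
  obtain ⟨m, hm⟩ := boundedBelow_kerCoeff isTrig b a i
  refine ⟨min m 0, fun j hj => ?_⟩
  have h1 := gker_of_neg isTrig b j (by omega)
  have h2 : cauchyProd (gker isTrig a) (fun k => kerCoeff isTrig a b k j) i = 0 := by
    simp only [cauchyProd, kerCoeff_of_neg_right _ _ _ _ _ (show j < 0 by omega), zero_smul,
      finsum_zero]
  have h3 : cauchyProd (gker isTrig b) (fun k => kerCoeff isTrig b a k i) j = 0 := by
    rw [cauchyProd]
    refine finsum_eq_zero_of_forall_eq_zero fun p => ?_
    rcases lt_or_ge p 0 with hp | hp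
    · rw [gker_of_neg _ _ _ hp, smul_zero]
    · rw [show kerCoeff isTrig b a (j - p) i = 0 from hm _ (by omega), zero_smul]
  rw [curvCoeff, h1, h2, h3]
  simp

theorem curvCoeff_of_ne (isTrig : Bool) {a b : CP1} (hab : a ≠ b) (i j : ℤ) :
    curvCoeff isTrig a b i j = 0 := by
  refine eq_zero_of_mulVar_eq (b := b) (boundedBelow_curvCoeff isTrig a b i) (fun n => ?_) j
  have : kerDefect isTrig a b i = 0 := funext (kerDefect_of_ne isTrig hab i)
  rw [mulVar_curvCoeff, this]
  cases isTrig <;> cases b <;> simp [twist, mulVar]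

theorem curvCoeff_self (isTrig : Bool) (a : CP1) (i j : ℤ) :
    curvCoeff isTrig a a (i + 1) (j - 1) = curvCoeff isTrig a a i j := by
  obtain ⟨m, hm⟩ := boundedBelow_curvCoeff isTrig a a i
  obtain ⟨m', hm'⟩ := boundedBelow_curvCoeff isTrig a a (i + 1)
  rw [← sub_eq_zero]
  refine eq_zero_of_mulVar_eq (b := a)
    (g := fun j => curvCoeff isTrig a a (i + 1) (j - 1) - curvCoeff isTrig a a i j)
    ⟨min m m', fun n hn => ?_⟩ (fun n => ?_) j
  · rw [hm n (by omega), hm' (n - 1) (by omega), sub_zero]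
  have hs : ∀ f : ℤ → Rf, mulVar a (fun j => f (j - 1)) n = mulVar a f (n - 1) := by
    intro f
    cases a <;> simp [mulVar]
  have h1 := mulVar_curvCoeff isTrig a a (i + 1) (n - 1)
  have h2 := mulVar_curvCoeff isTrig a a i n
  have h3 : twist isTrig a (kerDefect isTrig a a (i + 1)) (n - 1) =
      twist isTrig a (kerDefect isTrig a a i) n := by
    cases isTrig
    · exact kerDefect_self _ _ _ _
    · cases a <;> simp [twist, mulVar, ← kerDefect_self _ _ i]
  rw [h3, ← h2] at h1
  rw [mulVar_sub, hs]
  linear_combination h1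

end Convolution

section ConstantPart

variable {R : Type*} [CommRing R] [Algebra ℂ R]

/-- entrywise weights of the constant part `P⁻ + ½P⁰` of the r-matrix -/
def constWeight (isTrig : Bool) (i j : Fin N) : ℂ :=
  if isTrig then (if j < i then 1 else 0) + (if i = j then 2⁻¹ else 0) else 0

/-- the constant part `P⁻ + ½P⁰` of the trigonometric r-matrix, zero in the rational case -/
def constPart (isTrig : Bool) : Matrix (Fin N) (Fin N) R →ₗ[ℂ] Matrix (Fin N) (Fin N) R where
  toFun M := Matrix.of fun i j => constWeight isTrig i j • M i j
  map_add' M M' := by ext; simp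
  map_smul' c M := by ext; simp [smul_comm c]

theorem constPart_apply (isTrig : Bool) (M : Matrix (Fin N) (Fin N) R) (i j : Fin N) :
    constPart isTrig M i j = constWeight isTrig i j • M i j := rfl

theorem constPart_false (M : Matrix (Fin N) (Fin N) R) : constPart false M = 0 := by
  ext; simp [constPart_apply, constWeight]

theorem constPart_eq_ite (isTrig : Bool) (M : Matrix (Fin N) (Fin N) R) :
    constPart isTrig M = if isTrig then lowP M + (2 : ℂ)⁻¹ • diagP M else 0 := by
  cases isTrig
  · simp [constPart_false]
  · ext i j
    simp [constPart_apply, constWeight, lowP, diagP, add_smul, ite_smul]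

theorem constPart_map (isTrig : Bool) (d : Derivation ℂ R R) (M : Matrix (Fin N) (Fin N) R) :
    constPart isTrig (M.map d) = (constPart isTrig M).map d := by
  ext; simp [constPart_apply]

theorem constWeight_mul (isTrig : Bool) (i j k : Fin N) (h : ¬(i = j ∧ j = k)) :
    constWeight isTrig i j * constWeight isTrig j k -
      constWeight isTrig i k * (constWeight isTrig i j + constWeight isTrig j k - 1) = 0 := by
  cases isTrig
  · simp [constWeight]
  · simp only [constWeight, if_true]
    split_ifs <;> first | omega | norm_num

theorem constPart_bracket (isTrig : Bool) (X Y : Matrix (Fin N) (Fin N) R) :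
    ⁅constPart isTrig X, constPart isTrig Y⁆ - constPart isTrig ⁅X, constPart isTrig Y⁆ -
      constPart isTrig ⁅constPart isTrig X, Y⁆ + constPart isTrig ⁅X, Y⁆ = 0 := by
  ext i k
  simp only [Ring.lie_def, Matrix.sub_apply, Matrix.add_apply, constPart_apply, Matrix.mul_apply,
    Matrix.zero_apply, ← Finset.sum_sub_distrib, ← Finset.sum_add_distrib, Finset.smul_sum]
  refine Finset.sum_eq_zero fun j _ => ?_
  simp only [smul_mul_assoc, mul_smul_comm, smul_smul, smul_sub]
  have key : (constWeight isTrig i j * constWeight isTrig j k - constWeight isTrig i k *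
      (constWeight isTrig i j + constWeight isTrig j k - 1)) •
        (X i j * Y j k - Y i j * X j k) = 0 := by
    by_cases h : i = j ∧ j = k
    · obtain ⟨rfl, rfl⟩ := h
      rw [mul_comm (X i i), sub_self, smul_zero]
    · rw [constWeight_mul isTrig i j k h, zero_smul]
  rw [← key]
  module

end ConstantPart

/-- the matrix `M ⊗ g` with entries in `A ⊗ ℂ(λ)` -/
def matTmul :
    Matrix (Fin N) (Fin N) A →ₗ[ℂ] Rf →ₗ[ℂ] Matrix (Fin N) (Fin N) (A ⊗[ℂ] Rf) :=
  LinearMap.mk₂ ℂ (fun M g => M.map fun x => x ⊗ₜ[ℂ] g)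
    (fun M M' g => by ext; simp [TensorProduct.add_tmul])
    (fun c M g => by ext; simp [TensorProduct.smul_tmul'])
    (fun M g g' => by ext; simp [TensorProduct.tmul_add])
    (fun c M g => by ext; simp)

theorem matTmul_apply (M : Matrix (Fin N) (Fin N) A) (g : Rf) :
    matTmul M g = M.map fun x => x ⊗ₜ[ℂ] g := rfl

theorem matTmul_mul (M M' : Matrix (Fin N) (Fin N) A) (g g' : Rf) :
    matTmul M g * matTmul M' g' = matTmul (M * M') (g * g') := by
  ext
  simp [matTmul_apply, Matrix.mul_apply, TensorProduct.sum_tmul]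

theorem lie_matTmul (M M' : Matrix (Fin N) (Fin N) A) (g g' : Rf) :
    ⁅matTmul M g, matTmul M' g'⁆ = matTmul ⁅M, M'⁆ (g * g') := by
  rw [Ring.lie_def, matTmul_mul, matTmul_mul, mul_comm g' g, Ring.lie_def, map_sub,
    LinearMap.sub_apply]

/-- entrywise extension of a derivation, as a linear map -/
def DextL (d : Derivation ℂ A A) :
    Matrix (Fin N) (Fin N) (A ⊗[ℂ] Rf) →ₗ[ℂ] Matrix (Fin N) (Fin N) (A ⊗[ℂ] Rf) :=
  (LinearMap.rTensor Rf (d : A →ₗ[ℂ] A)).mapMatrix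

theorem Dext_eq_DextL (d : Derivation ℂ A A) (M : Matrix (Fin N) (Fin N) (A ⊗[ℂ] Rf)) :
    Dext d M = DextL d M := rfl

theorem DextL_matTmul (d : Derivation ℂ A A) (M : Matrix (Fin N) (Fin N) A) (g : Rf) :
    DextL d (matTmul M g) = matTmul (M.map d) g := by
  ext
  simp [DextL, matTmul_apply]

section Curvature

attribute [local instance] LieRing.ofAssociativeRing

theorem finsum_eq_sum_of_notMem {ι V : Type*} [AddCommMonoid V] {f : ι → V} (s : Finset ι)
    (h : ∀ i ∉ s, f i = 0) : ∑ᶠ i, f i = ∑ i ∈ s, f i :=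
  finsum_eq_sum_of_support_subset f fun i hi => by_contra fun his => hi (h i his)

/-- the part of the Lax matrix coming from the scalar kernel, for the coefficients `x p` of
`μ_a^{-p}` relative to the index of the Lax matrix -/
def scalarLax (isTrig : Bool) (a : CP1) (x : ℤ → Matrix (Fin N) (Fin N) A) :
    Matrix (Fin N) (Fin N) (A ⊗[ℂ] Rf) :=
  ∑ᶠ p, matTmul (x p) (gker isTrig a p)

theorem Vlax_eq (isTrig : Bool) (Q : CP1 → ℤ → Matrix (Fin N) (Fin N) A) (b : CP1) (n : ℤ) :
    Vlax isTrig Q b n = scalarLax isTrig b (fun p => Q b (idx isTrig b n - p)) -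
      matTmul (constPart isTrig (Q b (idx isTrig b n - 0))) 1 := by
  rw [Vlax, scalarLax, constPart_eq_ite, sub_zero]
  cases isTrig
  · simp [matTmul_apply]
  · rfl

theorem iV_eq (isTrig : Bool) (Q : CP1 → ℤ → Matrix (Fin N) (Fin N) A) (a b : CP1) (n t : ℤ) :
    iV isTrig Q a b n t = ∑ᶠ p, kerCoeff isTrig a b t p • Q b (idx isTrig b n - p) -
      if t = 0 then constPart isTrig (Q b (idx isTrig b n - 0)) else 0 := by
  rw [iV, constPart_eq_ite, sub_zero]
  cases isTrig <;> simp [kerCoeff]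

theorem scalarLax_eq_sum (isTrig : Bool) (a : CP1) {x : ℤ → Matrix (Fin N) (Fin N) A} {v : ℤ}
    (hx : ∀ i, v < i → x i = 0) (s : Finset ℤ) (hs : Finset.Icc 0 v ⊆ s) :
    scalarLax isTrig a x = ∑ p ∈ s, matTmul (x p) (gker isTrig a p) := by
  refine finsum_eq_sum_of_notMem s fun p hp => ?_
  have hp' : p ∉ Finset.Icc 0 v := fun h => hp (hs h)
  rw [Finset.mem_Icc, not_and_or, not_le, not_le] at hp'
  rcases hp' with h | h
  · rw [gker_of_neg _ _ _ h, map_zero]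
  · rw [hx p h, map_zero, LinearMap.zero_apply]

variable {isTrig : Bool} {a b : CP1} {x y : ℤ → Matrix (Fin N) (Fin N) A}
  {d d' : Derivation ℂ A A} {v w : ℤ}

/-- the Lax equation for the coefficients `x` of an adelic element at `a`, along the flow whose
Lax matrix has the coefficients `y` at `b` -/
def LaxEquation (isTrig : Bool) (a b : CP1) (x y : ℤ → Matrix (Fin N) (Fin N) A)
    (d : Derivation ℂ A A) : Prop :=
  ∀ p, (x p).map d = ∑ᶠ u : ℤ, ⁅∑ᶠ q, kerCoeff isTrig a b u q • y q -
    (if u = 0 then constPart isTrig (y 0) else 0), x (p + u)⁆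

theorem LaxEquation.map_eq (hd : LaxEquation isTrig a b x y d) (hw : 0 ≤ w)
    (hx : ∀ i, v < i → x i = 0) (hy : ∀ i, v < i → y i = 0)
    (he : ∀ j ≤ v, ∀ i < -w, kerCoeff isTrig a b i j = 0) (p : ℤ) (hp : 0 ≤ p) :
    (x p).map d = -(∑ i ∈ Finset.Icc (-w) v, ∑ j ∈ Finset.Icc (-w) v,
      kerCoeff isTrig a b (i - p) j • ⁅x i, y j⁆) - ⁅constPart isTrig (y 0), x p⁆ := by
  have hin : ∀ u, ∑ᶠ q, kerCoeff isTrig a b u q • y q =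
      ∑ j ∈ Finset.Icc (-w) v, kerCoeff isTrig a b u j • y j := fun u => by
    refine finsum_eq_sum_of_notMem _ fun q hq => ?_
    rw [Finset.mem_Icc, not_and_or, not_le, not_le] at hq
    rcases hq with h | h
    · rw [kerCoeff_of_neg_right _ _ _ _ _ (by omega), zero_smul]
    · rw [hy q h, smul_zero]
  have hout : ∀ i ∉ Finset.Icc (-w) v,
      ⁅∑ j ∈ Finset.Icc (-w) v, kerCoeff isTrig a b (i - p) j • y j, x i⁆ = 0 := fun i hi => by
    rw [Finset.mem_Icc, not_and_or, not_le, not_le] at hi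
    rcases hi with h | h
    · rw [Finset.sum_eq_zero fun j hj => ?_, zero_lie]
      rw [he j (Finset.mem_Icc.1 hj).2 _ (by omega), zero_smul]
    · rw [hx i h, lie_zero]
  rw [hd p, ← finsum_comp_equiv (Equiv.subRight p)]
  have hterm : ∀ i, ⁅∑ᶠ q, kerCoeff isTrig a b (Equiv.subRight p i) q • y q -
      (if Equiv.subRight p i = 0 then constPart isTrig (y 0) else 0),
        x (p + Equiv.subRight p i)⁆ =
      ⁅∑ j ∈ Finset.Icc (-w) v, kerCoeff isTrig a b (i - p) j • y j, x i⁆ -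
        if i = p then ⁅constPart isTrig (y 0), x p⁆ else 0 := fun i => by
    rw [hin, sub_lie, Equiv.subRight_apply, add_sub_cancel]
    by_cases h : i = p
    · simp [h]
    · simp [h, sub_eq_zero]
  simp only [hterm]
  rw [finsum_sub_distrib, finsum_eq_sum_of_notMem _ hout,
    finsum_eq_single _ p fun i hi => if_neg hi, if_pos rfl, ← Finset.sum_neg_distrib]
  · congr 1
    refine Finset.sum_congr rfl fun i _ => ?_
    rw [← lie_skew, lie_sum, neg_inj]
    simp only [Ring.lie_def, mul_smul_comm, smul_mul_assoc, smul_sub]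
  · exact (Finset.finite_toSet (Finset.Icc (-w) v)).subset fun i hi =>
      by_contra fun h => hi (hout i h)
  · exact (Set.finite_singleton p).subset fun i hi => by_contra fun h => hi (if_neg h)

theorem LaxEquation.DextL_eq (hd : LaxEquation isTrig a b x y d) (hw : 0 ≤ w)
    (hx : ∀ i, v < i → x i = 0) (hy : ∀ i, v < i → y i = 0)
    (he : ∀ j ≤ v, ∀ i < -w, kerCoeff isTrig a b i j = 0) :
    DextL d (scalarLax isTrig a x - matTmul (constPart isTrig (x 0)) 1) =
      -(∑ i ∈ Finset.Icc (-w) v, ∑ j ∈ Finset.Icc (-w) v, matTmul ⁅x i, y j⁆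
          (cauchyProd (gker isTrig a) (fun k => kerCoeff isTrig a b k j) i)) -
        ⁅matTmul (constPart isTrig (y 0)) 1, scalarLax isTrig a x⁆ +
        matTmul (constPart isTrig (∑ i ∈ Finset.Icc (-w) v, ∑ j ∈ Finset.Icc (-w) v,
          kerCoeff isTrig a b i j • ⁅x i, y j⁆)) 1 +
        matTmul (constPart isTrig ⁅constPart isTrig (y 0), x 0⁆) 1 := by
  have hconv : ∀ i ∈ Finset.Icc (-w) v, ∀ j ∈ Finset.Icc (-w) v,
      cauchyProd (gker isTrig a) (fun k => kerCoeff isTrig a b k j) i =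
        ∑ p ∈ Finset.Icc 0 (v + w), kerCoeff isTrig a b (i - p) j • gker isTrig a p :=
    fun i hi j hj => by
      refine finsum_eq_sum_of_notMem _ fun p hp => ?_
      rw [Finset.mem_Icc] at hi hj
      rw [Finset.mem_Icc, not_and_or, not_le, not_le] at hp
      rcases hp with h | h
      · rw [gker_of_neg _ _ _ h, smul_zero]
      · beta_reduce
        rw [he j hj.2 _ (by omega), zero_smul]
  rw [scalarLax_eq_sum isTrig a hx (Finset.Icc 0 (v + w))
    (Finset.Icc_subset_Icc_right (by omega)), map_sub, map_sum, DextL_matTmul, ← constPart_map,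
    hd.map_eq hw hx hy he 0 le_rfl, lie_sum]
  have hsum : ∀ p ∈ Finset.Icc 0 (v + w), DextL d (matTmul (x p) (gker isTrig a p)) =
      -(∑ i ∈ Finset.Icc (-w) v, ∑ j ∈ Finset.Icc (-w) v,
        matTmul ⁅x i, y j⁆ (kerCoeff isTrig a b (i - p) j • gker isTrig a p)) -
        ⁅matTmul (constPart isTrig (y 0)) 1, matTmul (x p) (gker isTrig a p)⁆ := fun p hp => by
    rw [DextL_matTmul, hd.map_eq hw hx hy he p (Finset.mem_Icc.1 hp).1, lie_matTmul, one_mul]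
    simp only [map_sub, map_neg, map_sum, LinearMap.sub_apply, LinearMap.neg_apply,
      LinearMap.sum_apply, map_smul, LinearMap.smul_apply]
  rw [Finset.sum_congr rfl hsum, Finset.sum_sub_distrib, Finset.sum_neg_distrib, Finset.sum_comm,
    Finset.sum_congr rfl fun i hi => Finset.sum_comm]
  have hC : ∑ i ∈ Finset.Icc (-w) v, ∑ j ∈ Finset.Icc (-w) v, ∑ p ∈ Finset.Icc 0 (v + w),
      matTmul ⁅x i, y j⁆ (kerCoeff isTrig a b (i - p) j • gker isTrig a p) =
      ∑ i ∈ Finset.Icc (-w) v, ∑ j ∈ Finset.Icc (-w) v, matTmul ⁅x i, y j⁆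
          (cauchyProd (gker isTrig a) (fun k => kerCoeff isTrig a b k j) i) :=
    Finset.sum_congr rfl fun i hi => Finset.sum_congr rfl fun j hj => by
      rw [hconv i hi j hj, map_sum]
  rw [hC]
  simp only [sub_zero, map_sub, map_neg, LinearMap.sub_apply, LinearMap.neg_apply]
  abel

theorem curvature_eq_sum (hd : LaxEquation isTrig a b x y d) (hd' : LaxEquation isTrig b a y x d')
    (hv : 0 ≤ v) (hw : 0 ≤ w) (hx : ∀ i, v < i → x i = 0) (hy : ∀ i, v < i → y i = 0)
    (he : ∀ j ≤ v, ∀ i < -w, kerCoeff isTrig a b i j = 0)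
    (he' : ∀ j ≤ v, ∀ i < -w, kerCoeff isTrig b a i j = 0) :
    DextL d (scalarLax isTrig a x - matTmul (constPart isTrig (x 0)) 1) -
        DextL d' (scalarLax isTrig b y - matTmul (constPart isTrig (y 0)) 1) +
        ⁅scalarLax isTrig a x - matTmul (constPart isTrig (x 0)) 1,
          scalarLax isTrig b y - matTmul (constPart isTrig (y 0)) 1⁆ =
      ∑ i ∈ Finset.Icc (-w) v, ∑ j ∈ Finset.Icc (-w) v,
        (matTmul ⁅x i, y j⁆ (curvCoeff isTrig a b i j) +
          kerDefect isTrig a b i j • matTmul (constPart isTrig ⁅x i, y j⁆) 1) := by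
  have hI : Finset.Icc 0 v ⊆ Finset.Icc (-w) v := Finset.Icc_subset_Icc_left (by omega)
  have hff : ⁅scalarLax isTrig a x, scalarLax isTrig b y⁆ =
      ∑ i ∈ Finset.Icc (-w) v, ∑ j ∈ Finset.Icc (-w) v,
        matTmul ⁅x i, y j⁆ (gker isTrig a i * gker isTrig b j) := by
    rw [scalarLax_eq_sum isTrig a hx _ hI, scalarLax_eq_sum isTrig b hy _ hI, sum_lie]
    simp only [lie_sum, lie_matTmul]
  have hdelta : ∑ i ∈ Finset.Icc (-w) v, ∑ j ∈ Finset.Icc (-w) v,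
      (if isTrig = true ∧ i = 0 ∧ j = 0 then (1 : ℂ) else 0) •
        matTmul (constPart isTrig ⁅x i, y j⁆) 1 = matTmul (constPart isTrig ⁅x 0, y 0⁆) 1 := by
    have h0 : (0 : ℤ) ∈ Finset.Icc (-w) v := Finset.mem_Icc.2 ⟨by omega, hv⟩
    cases isTrig
    · simp [constPart_false]
    · rw [Finset.sum_eq_single_of_mem 0 h0 fun i _ hi => by simp [hi],
        Finset.sum_eq_single_of_mem 0 h0 fun j _ hj => by simp [hj]]
      simp
  have hbr := congrArg (fun M => matTmul M (1 : Rf))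
    (constPart_bracket isTrig (x 0) (y 0))
  simp only [map_sub, map_add, LinearMap.sub_apply, LinearMap.add_apply, map_zero,
    LinearMap.zero_apply] at hbr
  rw [hd.DextL_eq hw hx hy he, hd'.DextL_eq hw hy hx he', sub_lie, lie_sub, lie_sub, hff,
    lie_matTmul, one_mul]
  simp only [curvCoeff, kerDefect, map_sub, sub_smul, add_smul, Finset.sum_add_distrib,
    Finset.sum_sub_distrib, hdelta]
  simp only [map_sum, map_smul, LinearMap.sum_apply, LinearMap.smul_apply]
  rw [Finset.sum_comm (f := fun i j => matTmul ⁅y i, x j⁆ _),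
    Finset.sum_comm (f := fun i j => kerCoeff isTrig b a i j • _)]
  simp only [← lie_skew (y _) (x _), map_neg, LinearMap.neg_apply, smul_neg,
    Finset.sum_neg_distrib]
  rw [← lie_skew (scalarLax isTrig a x) (matTmul _ _), ← lie_skew (constPart isTrig (y 0)) (x 0),
    ← lie_skew (constPart isTrig (x 0)) (y 0), map_neg, map_neg, LinearMap.neg_apply,
    ← sub_eq_zero, ← hbr]
  rw [← lie_skew (constPart isTrig (x 0)) (y 0), map_neg, map_neg, LinearMap.neg_apply]
  abel

theorem eq_of_add_eq_add {V : Type*} {f : ℤ → ℤ → V} (hf : ∀ i j, f (i + 1) (j - 1) = f i j)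
    {i j i' j' : ℤ} (h : i + j = i' + j') : f i j = f i' j' := by
  have key : ∀ k : ℤ, ∀ i j, f (i + k) (j - k) = f i j := fun k => by
    induction k using Int.induction_on with
    | zero => simp
    | succ k ih => intro i j; rw [← add_assoc, ← sub_sub, hf, ih]
    | pred k ih =>
      intro i j
      rw [← ih i j, ← hf]
      congr 1 <;> ring
  rw [← key (i' - i) i j]
  congr 1 <;> omega

theorem curvCoeff_comm (isTrig : Bool) (a b : CP1) (i j : ℤ) :
    curvCoeff isTrig a b i j = curvCoeff isTrig b a j i := by
  rw [curvCoeff, curvCoeff, mul_comm, sub_right_comm]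

theorem kerDefect_of_lt (hw : 0 ≤ w) (he : ∀ j ≤ v, ∀ i < -w, kerCoeff isTrig a b i j = 0)
    {i j : ℤ} (hi : i < -w) (hj : j ≤ v) : kerDefect isTrig a b i j = 0 := by
  simp [kerDefect, he j hj i hi, kerCoeff_of_neg_right isTrig b a j i (by omega),
    show i ≠ 0 by omega]

theorem curvCoeff_of_lt (hw : 0 ≤ w) (he : ∀ j ≤ v, ∀ i < -w, kerCoeff isTrig a b i j = 0)
    {i j : ℤ} (hi : i < -w) (hj : j ≤ v) : curvCoeff isTrig a b i j = 0 := by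
  rw [curvCoeff, gker_of_neg isTrig a i (by omega), zero_mul, cauchyProd, cauchyProd,
    finsum_eq_zero_of_forall_eq_zero fun p => ?_, finsum_eq_zero_of_forall_eq_zero fun p => ?_,
    sub_zero, sub_zero]
  · rw [kerCoeff_of_neg_right isTrig b a _ i (by omega), zero_smul]
  · rcases lt_or_ge p 0 with hp | hp
    · rw [gker_of_neg _ _ _ hp, smul_zero]
    · rw [he j hj _ (by omega), zero_smul]

theorem sum_curvCoeff_self_eq_zero (X : ℤ → Matrix (Fin N) (Fin N) A) (m n : ℤ) (hw : 0 ≤ w)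
    (hm : ∀ i, v < i → X (m - i) = 0) (hn : ∀ i, v < i → X (n - i) = 0)
    (he : ∀ j ≤ v, ∀ i < -w, kerCoeff isTrig a a i j = 0) :
    ∑ i ∈ Finset.Icc (-w) v, ∑ j ∈ Finset.Icc (-w) v,
      (matTmul ⁅X (m - i), X (n - j)⁆ (curvCoeff isTrig a a i j) +
        kerDefect isTrig a a i j • matTmul (constPart isTrig ⁅X (m - i), X (n - j)⁆) 1) = 0 := by
  set φ : ℤ × ℤ → Matrix (Fin N) (Fin N) (A ⊗[ℂ] Rf) := fun p =>
    matTmul ⁅X (m - p.1), X (n - p.2)⁆ (curvCoeff isTrig a a p.1 p.2) +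
      kerDefect isTrig a a p.1 p.2 • matTmul (constPart isTrig ⁅X (m - p.1), X (n - p.2)⁆) 1
  have hφ : ∀ p ∉ Finset.Icc (-w) v ×ˢ Finset.Icc (-w) v, φ p = 0 := by
    rintro ⟨i, j⟩ hp
    simp only [φ]
    rcases lt_or_ge v i with hi | hi
    · simp [hm i hi]
    rcases lt_or_ge v j with hj | hj
    · simp [hn j hj]
    rw [Finset.mem_product, Finset.mem_Icc, Finset.mem_Icc] at hp
    rcases lt_or_ge i (-w) with hi' | hi'
    · simp [curvCoeff_of_lt hw he hi' hj, kerDefect_of_lt hw he hi' hj]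
    · have hj' : j < -w := by_contra fun h => hp ⟨⟨hi', hi⟩, not_lt.1 h, hj⟩
      rw [curvCoeff_comm, kerDefect_comm]
      simp [curvCoeff_of_lt hw he hj' hi, kerDefect_of_lt hw he hj' hi]
  rw [← Finset.sum_product' (f := fun i j => φ (i, j)), ← finsum_eq_sum_of_notMem _ hφ]
  let e : ℤ × ℤ ≃ ℤ × ℤ :=
    (Equiv.prodComm ℤ ℤ).trans ((Equiv.addLeft (m - n)).prodCongr (Equiv.addLeft (n - m)))
  have hanti : ∀ p, φ (e p) = -φ p := fun ⟨i, j⟩ => by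
    have h : m - n + j + (n - m + i) = i + j := by ring
    simp only [φ, e, Equiv.trans_apply, Equiv.prodComm_apply, Prod.swap_prod_mk,
      Equiv.prodCongr_apply, Prod.map_apply, Equiv.coe_addLeft]
    rw [eq_of_add_eq_add (curvCoeff_self isTrig a) h, eq_of_add_eq_add (kerDefect_self isTrig a) h,
      show m - (m - n + j) = n - j by ring, show n - (n - m + i) = m - i by ring, ← lie_skew]
    simp only [map_neg, LinearMap.neg_apply, smul_neg, neg_add]
  have hneg : ∑ᶠ p, φ p = -∑ᶠ p, φ p := by
    rw [← finsum_neg_distrib, ← finsum_comp_equiv e]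
    simp only [hanti]
  have : (2 : ℂ) • ∑ᶠ p, φ p = 0 := by
    rw [two_smul, ← eq_neg_iff_add_eq_zero]
    exact hneg
  exact (smul_eq_zero_iff_right two_ne_zero).1 this

theorem exists_kerCoeff_eq_zero (isTrig : Bool) (a b : CP1) (v : ℤ) :
    ∃ w, 0 ≤ w ∧ ∀ w' ≥ w, ∀ j ≤ v, ∀ i < -w', kerCoeff isTrig a b i j = 0 := by
  choose c hc using boundedBelow_kerCoeff isTrig a b
  refine ⟨∑ j ∈ Finset.Icc 0 v, |c j|, Finset.sum_nonneg fun _ _ => abs_nonneg _,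
    fun w' hw' j hj i hi => ?_⟩
  rcases lt_or_ge j 0 with hj0 | hj0
  · exact kerCoeff_of_neg_right _ _ _ _ _ hj0
  · have h1 := Finset.single_le_sum (f := fun j => |c j|) (fun _ _ => abs_nonneg _)
      (Finset.mem_Icc.2 ⟨hj0, hj⟩)
    have h2 := neg_abs_le (c j)
    exact hc j i (by omega)

theorem laxEquation_of_iV (isTrig : Bool) (Q : CP1 → ℤ → Matrix (Fin N) (Fin N) A) (a b : CP1)
    (m n : ℤ) (d : Derivation ℂ A A)
    (h : ∀ t : ℤ, (Q a t).map d = ∑ᶠ u : ℤ, (iV isTrig Q a b n u * Q a (t - u) -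
      Q a (t - u) * iV isTrig Q a b n u)) :
    LaxEquation isTrig a b (fun p => Q a (m - p)) (fun p => Q b (idx isTrig b n - p)) d := by
  intro p
  simp only [h, iV_eq, Ring.lie_def, sub_sub]

end Curvature

/-- the zero curvature equations in components.  If the Lax equations
`∂_{t^b_n} Q^a(λ_a) = [ι_{λ_a} V^b_n(λ), Q^a(λ_a)]` hold for all `a, b ∈ S` and
`n ≥ −Nb b`, then for all `a, b ∈ S`, `m ≥ −Nb a`, `n ≥ −Nb b`,
`∂_{t^b_n} V^a_m(λ) − ∂_{t^a_m} V^b_n(λ) + [V^a_m(λ), V^b_n(λ)] = 0` holds as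
`gl_N(A)`-valued rational functions of `λ`. -/
theorem zero_curvature_in_components (isTrig : Bool)
    (S : Finset CP1) (Nb : CP1 → ℤ)
    (Q : CP1 → ℤ → Matrix (Fin N) (Fin N) A)
    (hQS : ∀ b ∉ S, ∀ n, Q b n = 0)
    (hQbdd : ∀ b n, n < -(Nb b) → Q b n = 0)
    (D : CP1 → ℤ → Derivation ℂ A A)
    (hLax : ∀ a ∈ S, ∀ b ∈ S, ∀ n : ℤ, -(Nb b) ≤ n → ∀ t : ℤ,
      (Q a t).map (D b n) =
        ∑ᶠ u : ℤ, (iV isTrig Q a b n u * Q a (t - u)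
          - Q a (t - u) * iV isTrig Q a b n u)) :
    ∀ a ∈ S, ∀ b ∈ S, ∀ m : ℤ, -(Nb a) ≤ m → ∀ n : ℤ, -(Nb b) ≤ n →
      Dext (D b n) (Vlax isTrig Q a m) - Dext (D a m) (Vlax isTrig Q b n)
        + (Vlax isTrig Q a m * Vlax isTrig Q b n
            - Vlax isTrig Q b n * Vlax isTrig Q a m) = 0 := by
  intro a ha b hb m hm n hn
  set v : ℤ := max 0 (max (idx isTrig a m + Nb a) (idx isTrig b n + Nb b)) with hv
  have hx : ∀ i, v < i → Q a (idx isTrig a m - i) = 0 := fun i hi => hQbdd _ _ (by omega)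
  have hy : ∀ i, v < i → Q b (idx isTrig b n - i) = 0 := fun i hi => hQbdd _ _ (by omega)
  obtain ⟨w₁, hw₁, he₁⟩ := exists_kerCoeff_eq_zero isTrig a b v
  obtain ⟨w₂, hw₂, he₂⟩ := exists_kerCoeff_eq_zero isTrig b a v
  have he := he₁ (max w₁ w₂) (le_max_left _ _)
  have hw : 0 ≤ max w₁ w₂ := le_max_of_le_left hw₁
  rw [Dext_eq_DextL, Dext_eq_DextL, Vlax_eq, Vlax_eq, ← Ring.lie_def]
  refine (curvature_eq_sum (laxEquation_of_iV isTrig Q a b _ n (D b n) (hLax a ha b hb n hn))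
    (laxEquation_of_iV isTrig Q b a _ m (D a m) (hLax b hb a ha m hm)) (le_max_left _ _) hw hx hy
    he (he₂ _ (le_max_right _ _))).trans ?_
  by_cases hab : a = b
  · subst hab
    exact sum_curvCoeff_self_eq_zero (Q a) _ _ hw hx hy he
  · simp [curvCoeff_of_ne isTrig hab, kerDefect_of_ne isTrig hab]

end
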